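/- arXiv:1812.04916 — 8 statements merged into one kernel-verified Lean document; each statement's English description precedes it below -/
import Mathlib

section
/- Let A = (a_{ij}) be an n×n complex matrix such that every row of A has the same sum γ. Then for each index k ∈ {1,…,n}, the matrix A is similar (over ℂ) to the block upper triangular matrix [[γ, a(k)ᵀ],[0, A(k)]], where a(k)ᵀ = (a_{k1},…,a_{k,k−1},a_{k,k+1},…,a_{kn}) is the k-th row of A with its k-th entry deleted, and A(k) is the (n−1)×(n−1) matrix whose (j,l) entry (for j,l ≠ k) is a_{jl} − a_{kl}. In particular, γ is an eigenvalue of A. -/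
set_option autoImplicit false

open Matrix

/-- Left multiplication by the identity matrix whose `k`-th column is replaced by ones
adds the `k`-th row to every other row. -/
theorem updateCol_one_mul_apply {ι R : Type*} [Fintype ι] [DecidableEq ι] [Semiring R]
    (N : Matrix ι ι R) (k i j : ι) :
    (((1 : Matrix ι ι R).updateCol k 1) * N) i j = N k j + if i = k then 0 else N i j := by
  have h : ∀ x, ((1 : Matrix ι ι R).updateCol k 1) i x =
      (if k = x then 1 else 0) + (if i = x then (if i = k then 0 else 1) else 0) := by
    intro x
    simp only [Matrix.updateCol_apply, Matrix.one_apply, Pi.one_apply]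
    by_cases hx : x = k
    · subst hx
      by_cases hi : i = x <;> simp [hi]
    · have hx' : ¬ k = x := fun h => hx h.symm
      by_cases hi : i = x <;> simp [hx, hx', hi]
  simp [Matrix.mul_apply, h, add_mul, Finset.sum_add_distrib]

/-- Right multiplication by the identity matrix whose `k`-th column is replaced by ones
replaces the `k`-th column by the row sums. -/
theorem mul_updateCol_one_apply {ι R : Type*} [Fintype ι] [DecidableEq ι] [Semiring R]
    (A : Matrix ι ι R) (k i j : ι) :
    (A * (1 : Matrix ι ι R).updateCol k 1) i j = if j = k then ∑ l, A i l else A i j := by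
  by_cases hj : j = k <;>
    simp [Matrix.mul_apply, Matrix.one_apply, hj]

theorem isUnit_updateCol_one {ι R : Type*} [Fintype ι] [DecidableEq ι] [CommRing R] (k : ι) :
    IsUnit ((1 : Matrix ι ι R).updateCol k 1) := by
  rw [Matrix.isUnit_iff_isUnit_det, ← Matrix.cramer_apply, Matrix.cramer_one]
  simp

/-- If every row of the `n × n` complex matrix `A` has the same sum `γ`,
then for each index `k` the matrix `A` is similar to the block upper triangular matrix
`[[γ, a(k)ᵀ], [0, A(k)]]`, where `a(k)` is the `k`-deleted `k`-th row of `A` and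
`A(k)` has entries `A(k)_{jl} = a_{jl} - a_{kl}` for `j, l ≠ k`.
In particular, `γ` is an eigenvalue of `A`. -/
theorem stmt_0 {n : ℕ} (hn : 0 < n) (A : Matrix (Fin n) (Fin n) ℂ) (γ : ℂ)
    (hrow : ∀ i, ∑ j, A i j = γ) :
    (∀ k : Fin n,
      ∃ P : Matrix (Fin n) (Fin n) ℂ, IsUnit P ∧
        P⁻¹ * A * P =
          (Matrix.fromBlocks
              (Matrix.of fun (_ _ : {a : Fin n // a = k}) => γ)
              (Matrix.of fun (_ : {a : Fin n // a = k}) (l : {a : Fin n // ¬a = k}) =>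
                A k l.1)
              0
              (Matrix.of fun (j l : {a : Fin n // ¬a = k}) => A j.1 l.1 - A k l.1)).submatrix
            (Equiv.sumCompl (fun a : Fin n => a = k)).symm
            (Equiv.sumCompl (fun a : Fin n => a = k)).symm) ∧
    ∃ v : Fin n → ℂ, v ≠ 0 ∧ A.mulVec v = γ • v := by
  refine ⟨fun k => ⟨(1 : Matrix (Fin n) (Fin n) ℂ).updateCol k 1, isUnit_updateCol_one k, ?_⟩,
    1, ?_, ?_⟩
  · have hdet := (Matrix.isUnit_iff_isUnit_det _).mp (isUnit_updateCol_one (R := ℂ) k)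
    rw [Matrix.mul_assoc]
    refine (congrArg _ ?_).trans (Matrix.nonsing_inv_mul_cancel_left _ _ hdet)
    ext i j
    rw [mul_updateCol_one_apply, updateCol_one_mul_apply, hrow]
    by_cases hi : i = k <;> by_cases hj : j = k <;>
      simp [hi, hj, Equiv.sumCompl_symm_apply_of_pos, Equiv.sumCompl_symm_apply_of_neg]
  · exact fun h => one_ne_zero (congrFun h ⟨0, hn⟩)
  · ext i
    simp [Matrix.mulVec, dotProduct, hrow]
end

section
/- Let A = (a_{ij}) be an n×n complex matrix such that every row of A has the same sum γ. Then for each index k ∈ {1,…,n}, every eigenvalue of A is either equal to γ or is an eigenvalue of the (n−1)×(n−1) matrix A(k) whose (j,l) entry (for j,l ≠ k) is a_{jl} − a_{kl}. -/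
set_option autoImplicit false

open Matrix

/-- If every row of the `n × n` complex matrix `A` has the same sum `γ`,
then for each index `k`, every eigenvalue of `A` is either `γ` or an eigenvalue of the
`(n-1) × (n-1)` matrix `A(k)` with entries `A(k)_{jl} = a_{jl} - a_{kl}` for `j, l ≠ k`. -/
theorem stmt_1 {n : ℕ} (A : Matrix (Fin n) (Fin n) ℂ) (γ : ℂ)
    (hrow : ∀ i, ∑ j, A i j = γ) (k : Fin n) (μ : ℂ)
    (v : Fin n → ℂ) (hv : v ≠ 0) (hev : A.mulVec v = μ • v) :
    μ = γ ∨ ∃ w : {j : Fin n // j ≠ k} → ℂ, w ≠ 0 ∧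
      (Matrix.of fun (j l : {j : Fin n // j ≠ k}) => A j.1 l.1 - A k l.1).mulVec w = μ • w := by
  have hA : ∀ i, ∑ l, A i l * v l = μ * v i := fun i => congrFun hev i
  have hdiff : ∀ i, ∑ l, A i l * (v l - v k) = μ * v i - γ * v k := fun i => by
    simp only [mul_sub, Finset.sum_sub_distrib, hA, ← Finset.sum_mul, hrow]
  by_cases hconst : ∀ j, v j = v k
  · left
    have hk : v k ≠ 0 := fun h => hv (funext fun j => (hconst j).trans h)
    have h := hdiff k
    simp only [hconst, sub_self, mul_zero, Finset.sum_const_zero] at h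
    exact mul_right_cancel₀ hk (sub_eq_zero.mp h.symm)
  · right
    push Not at hconst
    obtain ⟨i, hi⟩ := hconst
    refine ⟨fun j => v j.1 - v k, fun h => ?_, funext fun j => ?_⟩
    · exact sub_ne_zero.mpr hi (congrFun h ⟨i, fun hik => hi (hik ▸ rfl)⟩)
    · have hsum := Fintype.sum_eq_add_sum_subtype_ne
        (fun l => (A j.1 l - A k l) * (v l - v k)) k
      simp only [sub_self, mul_zero, zero_add] at hsum
      change ∑ l : {l : Fin n // l ≠ k}, (A j.1 l.1 - A k l.1) * (v l.1 - v k)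
        = μ * (v j.1 - v k)
      rw [← hsum]
      simp only [sub_mul, Finset.sum_sub_distrib, hdiff]
      ring
end

section
/- Let G be a connected d-regular simple graph on n vertices with adjacency eigenvalues λ₁ ≥ λ₂ ≥ … ≥ λₙ. Then −d/(n−1) − (1/(n−1))·√((n−2)·n·d·(n−d−1)) ≤ λₙ ≤ −d/(n−1) − (1/(n−1))·√(n·d·(n−d−1)/(n−2)), and −d/(n−1) + (1/(n−1))·√(n·d·(n−d−1)/(n−2)) ≤ λ₂ ≤ −d/(n−1) + (1/(n−1))·√((n−2)·n·d·(n−d−1)). -/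
set_option autoImplicit false

open Matrix Polynomial

theorem Finset.sq_mul_card_le_of_sum_eq_zero {ι : Type*} (s : Finset ι) (y : ι → ℝ)
    (hy : ∑ i ∈ s, y i = 0) {k : ι} (hk : k ∈ s) :
    s.card * y k ^ 2 ≤ (s.card - 1) * ∑ i ∈ s, y i ^ 2 := by
  classical
  have h := sq_sum_le_card_mul_sum_sq (s := s.erase k) (f := y)
  have h1 := Finset.add_sum_erase s y hk
  have h2 := Finset.add_sum_erase s (fun i => y i ^ 2) hk
  have hc : ((s.erase k).card : ℝ) = s.card - 1 := by
    rw [← Finset.card_erase_add_one hk]; push_cast; ring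
  rw [hc] at h
  have h3 : ∑ i ∈ s.erase k, y i = -y k := by linarith
  have h4 : ∑ i ∈ s.erase k, y i ^ 2 = ∑ i ∈ s, y i ^ 2 - y k ^ 2 := by
    linarith
  rw [h3, h4] at h
  nlinarith

theorem Finset.sum_sq_le_of_sum_eq_zero_of_le {ι : Type*} (s : Finset ι) (y : ι → ℝ)
    (hy : ∑ i ∈ s, y i = 0) {M : ℝ} (hM : ∀ i ∈ s, y i ≤ M) :
    ∑ i ∈ s, y i ^ 2 ≤ s.card * (s.card - 1) * M ^ 2 := by
  have h := Finset.sum_sq_le_sq_sum_of_nonneg (s := s) (f := fun i => M - y i)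
    (fun i hi => sub_nonneg.2 (hM i hi))
  simp only [sub_sq, Finset.sum_add_distrib, Finset.sum_sub_distrib, ← Finset.mul_sum, hy,
    Finset.sum_const, nsmul_eq_mul] at h
  linarith

/-- Bounds for the largest of finitely many reals with zero sum, in terms of their
sum of squares. -/
theorem Finset.bounds_of_sum_eq_zero_of_le {ι : Type*} (s : Finset ι) (y : ι → ℝ)
    (hy : ∑ i ∈ s, y i = 0) {k : ι} (hk : k ∈ s) (hmax : ∀ i ∈ s, y i ≤ y k) {R : ℝ}
    (hR : R = s.card * ∑ i ∈ s, y i ^ 2) :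
    1 / (s.card : ℝ) * √(R / (s.card - 1)) ≤ y k ∧
      y k ≤ 1 / (s.card : ℝ) * √((s.card - 1) * R) := by
  have hc : (1 : ℝ) ≤ s.card := by exact_mod_cast Finset.card_pos.2 ⟨k, hk⟩
  have hc0 : (0 : ℝ) < s.card := by linarith
  have h1 := s.sq_mul_card_le_of_sum_eq_zero y hy hk
  have h2 := s.sum_sq_le_of_sum_eq_zero_of_le y hy hmax
  have h0 : 0 ≤ s.card * y k := by
    have := Finset.sum_le_card_nsmul s y _ hmax
    rwa [hy, nsmul_eq_mul] at this
  rw [one_div, inv_mul_le_iff₀ hc0, le_inv_mul_iff₀ hc0]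
  constructor
  · rw [Real.sqrt_le_iff]
    refine ⟨h0, div_le_of_le_mul₀ (by linarith) (sq_nonneg _) ?_⟩
    rw [hR]
    calc _ ≤ (s.card : ℝ) * (s.card * (s.card - 1) * y k ^ 2) := by gcongr
      _ = _ := by ring
  · apply Real.le_sqrt_of_sq_le
    rw [hR]
    calc _ = (s.card : ℝ) * (s.card * y k ^ 2) := by ring
      _ ≤ (s.card : ℝ) * ((s.card - 1) * ∑ i ∈ s, y i ^ 2) := by gcongr
      _ = _ := by ring

theorem Matrix.IsHermitian.trace_mul_self_eq_sum_eigenvalues_sq {m : Type*} [Fintype m]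
    [DecidableEq m] {A : Matrix m m ℝ} (hA : A.IsHermitian) :
    (A * A).trace = ∑ i, hA.eigenvalues i ^ 2 := by
  conv_lhs => rw [hA.spectral_theorem, ← map_mul, Unitary.conjStarAlgAut_apply, trace_mul_comm,
    ← mul_assoc]
  simp [Matrix.trace, sq]

namespace SimpleGraph

variable {V : Type*} [Fintype V] {G : SimpleGraph V} [DecidableRel G.Adj] {d : ℕ}

theorem IsRegularOfDegree.isRoot_charpoly_adjMatrix [DecidableEq V] [Nonempty V]
    (h : G.IsRegularOfDegree d) :
    (G.adjMatrix ℝ).charpoly.IsRoot d := by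
  rw [IsRoot, eval_charpoly, ← exists_mulVec_eq_zero_iff]
  refine ⟨Function.const V 1, ?_, ?_⟩
  · simp
  · ext v
    rw [sub_mulVec, Pi.sub_apply, adjMatrix_mulVec_const_apply_of_regular h, scalar_apply,
      mulVec_diagonal]
    simp

theorem IsRegularOfDegree.le_of_isRoot_charpoly_adjMatrix [DecidableEq V]
    (h : G.IsRegularOfDegree d) {t : ℝ} (ht : (G.adjMatrix ℝ).charpoly.IsRoot t) : t ≤ d := by
  rw [IsRoot, eval_charpoly, ← exists_mulVec_eq_zero_iff] at ht
  obtain ⟨v, hv, hv0⟩ := ht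
  obtain ⟨j, hj⟩ := Function.ne_iff.1 hv
  obtain ⟨i, -, hi⟩ := Finset.univ.exists_max_image (fun i => |v i|) ⟨j, Finset.mem_univ j⟩
  have hpos : 0 < |v i| := (abs_pos.2 hj).trans_le (hi j (Finset.mem_univ j))
  have he := congrFun hv0 i
  rw [sub_mulVec, Pi.sub_apply, adjMatrix_mulVec_apply, scalar_apply, mulVec_diagonal,
    Pi.zero_apply, sub_eq_zero] at he
  refine le_of_mul_le_mul_right ?_ hpos
  calc t * |v i| ≤ |t * v i| := by rw [abs_mul]; gcongr; exact le_abs_self t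
    _ ≤ ∑ u ∈ G.neighborFinset i, |v u| := by rw [he]; exact Finset.abs_sum_le_sum_abs _ _
    _ ≤ (G.neighborFinset i).card • |v i| :=
      Finset.sum_le_card_nsmul _ _ _ fun u _ => hi u (Finset.mem_univ u)
    _ = d * |v i| := by rw [card_neighborFinset_eq_degree, h i, nsmul_eq_mul]

theorem IsRegularOfDegree.trace_adjMatrix_mul_self (h : G.IsRegularOfDegree d) :
    (G.adjMatrix ℝ * G.adjMatrix ℝ).trace = Fintype.card V * d := by
  simp only [Matrix.trace, diag_apply, adjMatrix_mul_self_apply_self, h _]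
  simp

end SimpleGraph

/-- Eigenvalue bounds for the second largest and the smallest adjacency
eigenvalues of a connected `d`-regular graph on `n` vertices. The eigenvalues of the
adjacency matrix, listed in decreasing order with multiplicity, are encoded by the
antitone function `μ : Fin n → ℝ` through the factorization of the characteristic
polynomial. -/
theorem stmt_4 {n d : ℕ} (hn : 2 ≤ n) (G : SimpleGraph (Fin n)) [DecidableRel G.Adj]
    (hconn : G.Connected) (hreg : G.IsRegularOfDegree d)
    (μ : Fin n → ℝ) (hanti : Antitone μ)
    (hchar : (G.adjMatrix ℝ).charpoly = ∏ i, (X - C (μ i))) :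
    (-(d : ℝ) / (n - 1) - (1 / ((n : ℝ) - 1)) *
          Real.sqrt (((n : ℝ) - 2) * ((n : ℝ) * d * ((n : ℝ) - d - 1)))
        ≤ μ ⟨n - 1, by omega⟩ ∧
      μ ⟨n - 1, by omega⟩ ≤
        -(d : ℝ) / (n - 1) - (1 / ((n : ℝ) - 1)) *
          Real.sqrt (((n : ℝ) * d * ((n : ℝ) - d - 1)) / ((n : ℝ) - 2))) ∧
    (-(d : ℝ) / (n - 1) + (1 / ((n : ℝ) - 1)) *
          Real.sqrt (((n : ℝ) * d * ((n : ℝ) - d - 1)) / ((n : ℝ) - 2))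
        ≤ μ ⟨1, by omega⟩ ∧
      μ ⟨1, by omega⟩ ≤
        -(d : ℝ) / (n - 1) + (1 / ((n : ℝ) - 1)) *
          Real.sqrt (((n : ℝ) - 2) * ((n : ℝ) * d * ((n : ℝ) - d - 1)))) := by
  have : NeZero n := ⟨by omega⟩
  have hH : (G.adjMatrix ℝ).IsHermitian := by
    rw [IsHermitian, conjTranspose_eq_transpose_of_trivial, SimpleGraph.transpose_adjMatrix]
  have hroot (t : ℝ) : (G.adjMatrix ℝ).charpoly.IsRoot t ↔ ∃ i, μ i = t := by
    rw [hchar, IsRoot, eval_prod, Finset.prod_eq_zero_iff]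
    simp [sub_eq_zero, eq_comm]
  have hmap : Finset.univ.val.map hH.eigenvalues = Finset.univ.val.map μ := by
    have h1 := hH.roots_charpoly_eq_eigenvalues
    rw [hchar, roots_prod _ _ (Finset.prod_ne_zero_iff.2 fun i _ => X_sub_C_ne_zero _)] at h1
    simpa using h1.symm
  have hsum : ∑ i, μ i = 0 := by
    have h1 : (G.adjMatrix ℝ).trace = ∑ i, hH.eigenvalues i := by
      simpa using hH.trace_eq_sum_eigenvalues
    rw [SimpleGraph.trace_adjMatrix] at h1
    rw [h1]
    exact (congrArg Multiset.sum hmap).symm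
  have hsq : ∑ i, μ i ^ 2 = n * d := by
    have h1 := hH.trace_mul_self_eq_sum_eigenvalues_sq
    rw [hreg.trace_adjMatrix_mul_self, Fintype.card_fin] at h1
    have h2 := congrArg (fun s => (s.map fun x : ℝ => x ^ 2).sum) hmap
    simp only [Multiset.map_map] at h2
    exact h2.symm.trans h1.symm
  have hμ0 : μ 0 = d := by
    apply le_antisymm
    · exact hreg.le_of_isRoot_charpoly_adjMatrix ((hroot _).2 ⟨0, rfl⟩)
    · obtain ⟨i, hi⟩ := (hroot d).1 hreg.isRoot_charpoly_adjMatrix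
      rw [← hi]
      exact hanti (Fin.zero_le i)
  set s : Finset (Fin n) := Finset.univ.erase 0 with hs
  have hn' : (2 : ℝ) ≤ n := by exact_mod_cast hn
  have hn1 : (n : ℝ) - 1 ≠ 0 := by linarith
  have hcard : (s.card : ℝ) = n - 1 := by
    rw [hs, Finset.card_erase_of_mem (Finset.mem_univ _), Finset.card_univ, Fintype.card_fin,
      Nat.cast_sub (by omega), Nat.cast_one]
  have hsum' : ∑ i ∈ s, μ i = -d := by
    have := Finset.add_sum_erase Finset.univ μ (Finset.mem_univ 0)
    rw [hsum, hμ0] at this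
    linarith
  have hsq' : ∑ i ∈ s, μ i ^ 2 = n * d - d ^ 2 := by
    have := Finset.add_sum_erase Finset.univ (fun i => μ i ^ 2) (Finset.mem_univ 0)
    simp only [hsq, hμ0] at this
    linarith
  set a : ℝ := -(d : ℝ) / (n - 1) with ha
  have hy : ∑ i ∈ s, (μ i - a) = 0 := by
    rw [Finset.sum_sub_distrib, hsum', Finset.sum_const, nsmul_eq_mul, hcard, ha]
    field_simp
    ring
  have hR : (n : ℝ) * d * (n - d - 1) = s.card * ∑ i ∈ s, (μ i - a) ^ 2 := by
    simp only [sub_sq, Finset.sum_add_distrib, Finset.sum_sub_distrib, ← Finset.mul_sum,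
      ← Finset.sum_mul, hsum', hsq', Finset.sum_const, nsmul_eq_mul, hcard, ha]
    field_simp
    ring
  have hmem (k : Fin n) (hk : k.1 ≠ 0) : k ∈ s := by
    exact Finset.mem_erase.2 ⟨fun h => hk (by rw [h, Fin.val_zero]), Finset.mem_univ k⟩
  have hlast := s.bounds_of_sum_eq_zero_of_le (fun i => -(μ i - a))
    (by rw [Finset.sum_neg_distrib, hy, neg_zero]) (hmem ⟨n - 1, by omega⟩ (by simp; omega))
    (fun i _ => by
      have := hanti (show i ≤ ⟨n - 1, by omega⟩ from Fin.le_def.2 (by simp; omega))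
      linarith)
    (by simpa only [neg_sq] using hR)
  have hsecond := s.bounds_of_sum_eq_zero_of_le (fun i => μ i - a) hy
    (hmem ⟨1, by omega⟩ (by simp))
    (fun i hi => by
      have hi0 : i.1 ≠ 0 := fun h => Finset.ne_of_mem_erase hi (Fin.ext h)
      have := hanti (show ⟨1, by omega⟩ ≤ i from Fin.le_def.2 (by simp; omega))
      linarith)
    hR
  rw [hcard, show (n : ℝ) - 1 - 1 = n - 2 by ring] at hlast hsecond
  refine ⟨⟨?_, ?_⟩, ?_, ?_⟩ <;> linarith [hlast.1, hlast.2, hsecond.1, hsecond.2]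
end

section
/- Let G be a connected d-regular simple graph on n vertices with adjacency eigenvalues λ₁ ≥ λ₂ ≥ … ≥ λₙ. For distinct vertices i, k define α_{ik} = 1 + 2N(i,k) if k ∼ i and α_{ik} = 2N(i,k) if k ≁ i, and define β_{ik} = 3 + 2N(i,k) if k ∼ i and β_{ik} = 2N(i,k) if k ≁ i. Then −2d + max( d, max_i min_{k ≠ i} α_{ik} ) ≤ λₙ ≤ λ₂ ≤ 2d − max( d, max_i min_{k ≠ i} β_{ik} ). -/
set_option autoImplicit false

open Matrix Polynomial

/-- The number of common neighbours `N(i,k)` of two vertices, as а real number. -/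
noncomputable def commonNbrs {n : ℕ} (G : SimpleGraph (Fin n)) [DecidableRel G.Adj]
    (i k : Fin n) : ℝ :=
  ((G.neighborFinset i ∩ G.neighborFinset k).card : ℝ)

/-- `α_{ik} = 1 + 2N(i,k)` if `k ∼ i`, and `α_{ik} = 2N(i,k)` if `k ≁ i`. -/
noncomputable def alpha9 {n : ℕ} (G : SimpleGraph (Fin n)) [DecidableRel G.Adj]
    (i k : Fin n) : ℝ :=
  if G.Adj k i then 1 + 2 * commonNbrs G i k else 2 * commonNbrs G i k

/-- `β_{ik} = 3 + 2N(i,k)` if `k ∼ i`, and `β_{ik} = 2N(i,k)` if `k ≁ i`. -/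
noncomputable def beta9 {n : ℕ} (G : SimpleGraph (Fin n)) [DecidableRel G.Adj]
    (i k : Fin n) : ℝ :=
  if G.Adj k i then 3 + 2 * commonNbrs G i k else 2 * commonNbrs G i k

/-- For a `d`-regular graph whose adjacency matrix has characteristic polynomial `∏ i, (X - μ i)`,
the eigenvalue `μ j` has a nonconstant eigenvector provided it differs from `d` or `d` is also
the value of `μ` at another index `i`. -/
theorem exists_nonconstant_eigenvector {n d : ℕ} (G : SimpleGraph (Fin n)) [DecidableRel G.Adj]
    (hreg : G.IsRegularOfDegree d) (μ : Fin n → ℝ)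
    (hchar : (G.adjMatrix ℝ).charpoly = ∏ i, (Polynomial.X - Polynomial.C (μ i)))
    (i j : Fin n) (hij : i ≠ j) (hd : μ j = d → μ i = d) :
    ∃ x : Fin n → ℝ, G.adjMatrix ℝ *ᵥ x = μ j • x ∧ ∃ p q, x p ≠ x q := by
  classical
  have hA : (G.adjMatrix ℝ).IsHermitian := by
    simp [Matrix.IsHermitian, conjTranspose_eq_transpose_of_trivial]
  have hroots : Finset.univ.val.map hA.eigenvalues = Finset.univ.val.map μ := by
    have h1 := hA.roots_charpoly_eq_eigenvalues
    rw [hchar, Polynomial.roots_prod _ _ (Finset.prod_ne_zero_iff.mpr fun a _ =>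
      Polynomial.X_sub_C_ne_zero _)] at h1
    simpa [Multiset.bind_singleton] using h1.symm
  have hcount : ∀ t : ℝ, (Finset.univ.filter fun a => t = hA.eigenvalues a).card =
      (Finset.univ.filter fun a => t = μ a).card := by
    intro t
    have h := congrArg (Multiset.count t) hroots
    rwa [Multiset.count_map, Multiset.count_map] at h
  have hconst : ∀ x : Fin n → ℝ, x ≠ 0 → (∀ p q, x p = x q) →
      G.adjMatrix ℝ *ᵥ x = μ j • x → μ j = d := by
    intro x hx hc he
    obtain ⟨p, hp⟩ := Function.ne_iff.mp hx
    have h := congrFun he p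
    have hxp : x = Function.const _ (x p) := funext fun q => hc q p
    rw [hxp, SimpleGraph.adjMatrix_mulVec_const_apply_of_regular hreg] at h
    simp only [Pi.smul_apply, Function.const_apply, smul_eq_mul] at h
    exact (mul_right_cancel₀ hp h).symm
  by_contra! hno
  have hvec : ∀ a, hA.eigenvalues a = μ j →
      ∀ p q, hA.eigenvectorBasis a p = hA.eigenvectorBasis a q := by
    intro a ha
    exact hno _ (ha ▸ hA.mulVec_eigenvectorBasis a)
  have hne : ∀ a, (⇑(hA.eigenvectorBasis a) : Fin n → ℝ) ≠ 0 := by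
    intro a h
    refine hA.eigenvectorBasis.orthonormal.ne_zero a ?_
    ext p
    exact congrFun h p
  obtain ⟨a, ha⟩ : (Finset.univ.filter fun a => μ j = hA.eigenvalues a).Nonempty := by
    rw [← Finset.card_pos, hcount]
    exact Finset.card_pos.mpr ⟨j, by simp⟩
  have ha' : hA.eigenvalues a = μ j := (Finset.mem_filter.mp ha).2.symm
  have hjd : μ j = d :=
    hconst _ (hne a) (hvec a ha') (ha' ▸ hA.mulVec_eigenvectorBasis a)
  obtain ⟨b, hb, c, hc, hbc⟩ := Finset.one_lt_card.mp
    (show 1 < (Finset.univ.filter fun a => μ j = hA.eigenvalues a).card by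
      rw [hcount]
      exact Finset.one_lt_card.mpr ⟨i, by simp [hjd, hd hjd], j, by simp, hij⟩)
  have hb' := hvec b (Finset.mem_filter.mp hb).2.symm
  have hc' := hvec c (Finset.mem_filter.mp hc).2.symm
  obtain ⟨p, hp⟩ := Function.ne_iff.mp (hne b)
  have horth : inner ℝ (hA.eigenvectorBasis b) (hA.eigenvectorBasis c) = 0 :=
    hA.eigenvectorBasis.orthonormal.2 hbc
  rw [PiLp.inner_apply, Finset.sum_congr rfl fun q _ => by rw [hb' q p, hc' q p]] at horth
  have hn : (n : ℝ) ≠ 0 := by exact_mod_cast (Fin.pos p).ne'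
  have hcp : hA.eigenvectorBasis c p = 0 := by
    simpa [hn, show hA.eigenvectorBasis b p ≠ 0 from hp] using horth
  exact hne c (funext fun q => (hc' q p).trans hcp)

/-- The eigenvalues of a `d`-regular graph have absolute value at most `d`. -/
theorem abs_eigenvalue_le_degree {n d : ℕ} (G : SimpleGraph (Fin n)) [DecidableRel G.Adj]
    (hreg : G.IsRegularOfDegree d) {t : ℝ} {x : Fin n → ℝ} (hx : x ≠ 0)
    (he : G.adjMatrix ℝ *ᵥ x = t • x) : |t| ≤ d := by
  obtain ⟨p, hp⟩ := Function.ne_iff.mp hx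
  obtain ⟨k, -, hk⟩ := Finset.exists_max_image Finset.univ (fun l => |x l|) ⟨p, Finset.mem_univ p⟩
  have hpos : 0 < |x k| := (abs_pos.mpr hp).trans_le (hk p (Finset.mem_univ p))
  have h := congrFun he k
  rw [SimpleGraph.adjMatrix_mulVec_apply, Pi.smul_apply, smul_eq_mul] at h
  refine le_of_mul_le_mul_right ?_ hpos
  calc |t| * |x k| = |∑ l ∈ G.neighborFinset k, x l| := by rw [h, abs_mul]
    _ ≤ ∑ l ∈ G.neighborFinset k, |x l| := Finset.abs_sum_le_sum_abs _ _
    _ ≤ ∑ l ∈ G.neighborFinset k, |x k| := Finset.sum_le_sum fun l _ => hk l (Finset.mem_univ l)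
    _ = d * |x k| := by
      rw [Finset.sum_const, SimpleGraph.card_neighborFinset_eq_degree, hreg k, nsmul_eq_mul]

/-- Gershgorin-type localization: an eigenvalue `t` with a nonconstant eigenvector lies, for every
vertex `i`, in the disc of some `k ≠ i` of the matrix obtained by subtracting row `i` from each
row of the adjacency matrix. -/
theorem exists_abs_add_adj_le {n d : ℕ} (G : SimpleGraph (Fin n)) [DecidableRel G.Adj]
    (hreg : G.IsRegularOfDegree d) {t : ℝ} {x : Fin n → ℝ} (hx : ∃ p q, x p ≠ x q)
    (he : G.adjMatrix ℝ *ᵥ x = t • x) (i : Fin n) :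
    ∃ k, k ≠ i ∧ |t + (if G.Adj k i then 1 else 0)| ≤
      2 * d - 2 * commonNbrs G i k - 2 * (if G.Adj k i then 1 else 0) := by
  obtain ⟨p, hp⟩ : ∃ p, x p - x i ≠ 0 := by
    by_contra! h
    obtain ⟨p, q, hpq⟩ := hx
    exact hpq (by linarith [h p, h q])
  obtain ⟨k, -, hk⟩ := Finset.exists_max_image Finset.univ (fun l => |x l - x i|)
    ⟨p, Finset.mem_univ p⟩
  have hpos : 0 < |x k - x i| := (abs_pos.mpr hp).trans_le (hk p (Finset.mem_univ p))
  have hki : k ≠ i := by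
    rintro rfl
    simp at hpos
  refine ⟨k, hki, ?_⟩
  set c : ℝ := if G.Adj k i then 1 else 0 with hc
  let a : Fin n → Fin n → ℝ := fun u l => if G.Adj u l then 1 else 0
  have hrow : ∀ u, ∑ l, a u l = d := by
    intro u
    simp only [a, Finset.sum_boole]
    rw [← hreg u, ← SimpleGraph.card_neighborFinset_eq_degree, SimpleGraph.neighborFinset_eq_filter]
  have hmul : ∀ u, ∑ l, a u l * x l = t * x u := by
    intro u
    have h := congrFun he u
    simpa [Matrix.mulVec, dotProduct, SimpleGraph.adjMatrix_apply, a] using h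
  have hcommon : ∑ l, a k l * a i l = commonNbrs G i k := by
    simp only [a, commonNbrs, SimpleGraph.neighborFinset_eq_filter, ← Finset.filter_and,
      ← ite_and, mul_ite, mul_one, mul_zero, Finset.sum_boole]
  have hdiff : ∑ l, (a k l - a i l) * (x l - x i) = t * (x k - x i) := by
    have : ∀ l, (a k l - a i l) * (x l - x i) =
        a k l * x l - a i l * x l - (a k l * x i - a i l * x i) := fun l => by ring
    simp only [this, Finset.sum_sub_distrib, ← Finset.sum_mul, hmul, hrow]
    ring
  set M := |x k - x i| with hM
  have hsum : ∑ l, (M * (a k l + a i l - 2 * (a k l * a i l)) - (if l = i then c * M else 0)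
      - (if l = k then c * M else 0)) = M * (2 * d - 2 * commonNbrs G i k - 2 * c) := by
    simp only [Finset.sum_sub_distrib, ← Finset.mul_sum, Finset.sum_add_distrib, hrow, hcommon,
      Finset.sum_ite_eq', Finset.mem_univ, if_true]
    ring
  have hdiff' : ∑ l, ((a k l - a i l) * (x l - x i) + (if l = k then c * (x k - x i) else 0)) =
      (t + c) * (x k - x i) := by
    simp only [Finset.sum_add_distrib, hdiff, Finset.sum_ite_eq', Finset.mem_univ, if_true]
    ring
  refine le_of_mul_le_mul_left ?_ hpos
  rw [← hsum, mul_comm, ← abs_mul, ← hdiff']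
  refine (Finset.abs_sum_le_sum_abs _ _).trans (Finset.sum_le_sum fun l _ => ?_)
  by_cases hlk : l = k
  · subst hlk
    have : G.Adj i l ↔ G.Adj l i := G.adj_comm i l
    by_cases hadj : G.Adj l i <;> simp [a, hc, this, hadj, hki]
  by_cases hli : l = i
  · subst hli
    by_cases hadj : G.Adj k l <;> simp [a, hc, hadj, hlk]
  have hl := hk l (Finset.mem_univ l)
  have h0 := abs_nonneg (x k - x i)
  by_cases h1 : G.Adj k l <;> by_cases h2 : G.Adj i l <;>
    norm_num [a, h1, h2, hlk, hli] <;> simpa [abs_sub_comm] using hl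

/-- For a connected `d`-regular graph on `n` vertices with adjacency
eigenvalues `λ₁ ≥ … ≥ λₙ` (encoded by an antitone `μ` via the characteristic polynomial),
`-2d + max(d, max_i min_{k ≠ i} α_{ik}) ≤ λₙ ≤ λ₂ ≤ 2d - max(d, max_i min_{k ≠ i} β_{ik})`. -/
theorem stmt_9 {n d : ℕ} (hn : 2 ≤ n) (G : SimpleGraph (Fin n)) [DecidableRel G.Adj]
    (hconn : G.Connected) (hreg : G.IsRegularOfDegree d)
    (μ : Fin n → ℝ) (hanti : Antitone μ)
    (hchar : (G.adjMatrix ℝ).charpoly = ∏ i, (Polynomial.X - Polynomial.C (μ i))) :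
    -(2 * (d : ℝ)) +
        max (d : ℝ) (⨆ i : Fin n, ⨅ k : {k : Fin n // k ≠ i}, alpha9 G i k.1)
      ≤ μ ⟨n - 1, by omega⟩ ∧
    μ ⟨n - 1, by omega⟩ ≤ μ ⟨1, by omega⟩ ∧
    μ ⟨1, by omega⟩ ≤
      2 * (d : ℝ) -
        max (d : ℝ) (⨆ i : Fin n, ⨅ k : {k : Fin n // k ≠ i}, beta9 G i k.1) := by
  have hn0 : Nonempty (Fin n) := ⟨⟨0, by omega⟩⟩
  have key : ∀ j : Fin n, 1 ≤ j.val →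
      ∃ x : Fin n → ℝ, G.adjMatrix ℝ *ᵥ x = μ j • x ∧ ∃ p q, x p ≠ x q := by
    intro j hj
    have h0j : (⟨0, by omega⟩ : Fin n) ≠ j := fun h => by simp [← h] at hj
    refine exists_nonconstant_eigenvector G hreg μ hchar ⟨0, by omega⟩ j h0j fun hjd => ?_
    by_contra hne
    obtain ⟨x, hx, p, q, hpq⟩ := exists_nonconstant_eigenvector G hreg μ hchar j ⟨0, by omega⟩
      h0j.symm fun h => absurd h hne
    have hle := abs_eigenvalue_le_degree G hreg (fun h => hpq (by simp [h])) hx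
    have hge := hanti (show (⟨0, by omega⟩ : Fin n) ≤ j from Nat.zero_le _)
    exact hne (le_antisymm ((le_abs_self _).trans hle) (hjd ▸ hge))
  obtain ⟨x, hx, hxc⟩ := key ⟨n - 1, by omega⟩ (by simp; omega)
  obtain ⟨y, hy, hyc⟩ := key ⟨1, by omega⟩ le_rfl
  have ne_zero : ∀ z : Fin n → ℝ, (∃ p q, z p ≠ z q) → z ≠ 0 := by
    rintro z ⟨p, q, hpq⟩ rfl
    exact hpq rfl
  have hxd := abs_le.mp (abs_eigenvalue_le_degree G hreg (ne_zero x hxc) hx)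
  have hyd := abs_le.mp (abs_eigenvalue_le_degree G hreg (ne_zero y hyc) hy)
  refine ⟨?_, hanti (Fin.mk_le_mk.mpr (by omega)), ?_⟩
  · rw [← le_sub_iff_add_le']
    refine max_le (by linarith) (ciSup_le fun i => ?_)
    obtain ⟨k, hki, hk⟩ := exists_abs_add_adj_le G hreg hxc hx i
    refine (ciInf_le (Set.finite_range _).bddBelow ⟨k, hki⟩).trans ?_
    have hk := (abs_le.mp hk).1
    unfold alpha9
    split_ifs at hk ⊢ <;> linarith
  · rw [le_sub_comm]
    refine max_le (by linarith) (ciSup_le fun i => ?_)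
    obtain ⟨k, hki, hk⟩ := exists_abs_add_adj_le G hreg hyc hy i
    refine (ciInf_le (Set.finite_range _).bddBelow ⟨k, hki⟩).trans ?_
    have hk := (abs_le.mp hk).2
    unfold beta9
    split_ifs at hk ⊢ <;> linarith
end

section
/- Let G be a connected simple graph on n vertices and let λ₁ ≥ λ₂ ≥ … ≥ λₙ be the eigenvalues of the normalized adjacency matrix 𝒜 = D⁻¹A. Then −1/(n−1) − (1/(n−1))·√((n−2)[2(n−1)R_{−1}(G) − n]) ≤ λₙ ≤ −1/(n−1) − (1/(n−1))·√((2(n−1)R_{−1}(G) − n)/(n−2)), and −1/(n−1) + (1/(n−1))·√((2(n−1)R_{−1}(G) − n)/(n−2)) ≤ λ₂ ≤ −1/(n−1) + (1/(n−1))·√((n−2)[2(n−1)R_{−1}(G) − n]). -/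
set_option autoImplicit false

open Matrix Polynomial

/-- The normalized adjacency matrix `𝒜 = D⁻¹ A` of a graph, with entries
`a_{ij} / d_i`. -/
noncomputable def normAdj {n : ℕ} (G : SimpleGraph (Fin n)) [DecidableRel G.Adj] :
    Matrix (Fin n) (Fin n) ℝ :=
  Matrix.of fun i j => (if G.Adj i j then (1 : ℝ) else 0) / (G.degree i : ℝ)

/-- The general Randić index `R_{-1}(G) = ∑_{i∼j} 1/(d_i d_j)`, the sum over the edges
`{i,j}` of `1/(d_i d_j)` (each unordered edge is counted twice in the double sum, whence
the division by `2`). -/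
noncomputable def randicM1 {n : ℕ} (G : SimpleGraph (Fin n)) [DecidableRel G.Adj] : ℝ :=
  (∑ i, ∑ j, if G.Adj i j then 1 / ((G.degree i : ℝ) * (G.degree j : ℝ)) else 0) / 2

namespace Matrix

variable {ι K : Type*} [Fintype ι] [DecidableEq ι] [Field K]

lemma trace_eq_sum_of_charpoly_eq_prod (M : Matrix ι ι K) (μ : ι → K)
    (h : M.charpoly = ∏ i, (X - C (μ i))) : M.trace = ∑ i, μ i := by
  have hs : M.charpoly.Splits := by
    rw [h]
    exact Polynomial.Splits.prod fun i _ => Polynomial.Splits.X_sub_C (μ i)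
  rw [trace_eq_sum_roots_charpoly_of_splits hs, h,
    show ∏ i, (X - C (μ i)) = ((Finset.univ.val.map μ).map fun a => X - C a).prod by
      rw [Multiset.map_map]; rfl,
    roots_multiset_prod_X_sub_C]
  rfl

lemma charpoly_mul_self_of_charpoly_eq_prod [Infinite K] (M : Matrix ι ι K) (μ : ι → K)
    (h : M.charpoly = ∏ i, (X - C (μ i))) :
    (M * M).charpoly = ∏ i, (X - C (μ i ^ 2)) := by
  apply Polynomial.expand_injective (R := K) (n := 2) two_pos
  apply Polynomial.funext
  intro t
  have h₁ : (scalar ι t - M).det = ∏ i, (t - μ i) := by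
    rw [← eval_charpoly, h, eval_prod]
    simp
  have h₂ : (scalar ι t + M).det = ∏ i, (t + μ i) := by
    have e : scalar ι t + M = -(scalar ι (-t) - M) := by
      rw [map_neg]
      abel
    rw [e, det_neg, ← eval_charpoly, h, eval_prod, Fintype.card, ← Finset.prod_const,
      ← Finset.prod_mul_distrib]
    exact Finset.prod_congr rfl fun i _ => by simp; ring
  have hc : scalar ι (t ^ 2) - M * M = (scalar ι t - M) * (scalar ι t + M) := by
    have : Commute (scalar ι t) M := scalar_commute t (fun r => Commute.all t r) M
    rw [map_pow, sub_mul, mul_add, mul_add, this.eq, sq]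
    abel
  rw [expand_eval, expand_eval, eval_charpoly, hc, det_mul, h₁, h₂, eval_prod,
    ← Finset.prod_mul_distrib]
  exact Finset.prod_congr rfl fun i _ => by simp; ring

lemma trace_mul_self_of_charpoly_eq_prod [Infinite K] (M : Matrix ι ι K) (μ : ι → K)
    (h : M.charpoly = ∏ i, (X - C (μ i))) : (M * M).trace = ∑ i, μ i ^ 2 :=
  trace_eq_sum_of_charpoly_eq_prod _ _ (charpoly_mul_self_of_charpoly_eq_prod M μ h)

lemma exists_mulVec_eq_smul_of_charpoly_isRoot (M : Matrix ι ι K) {t : K}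
    (h : M.charpoly.IsRoot t) : ∃ v, v ≠ 0 ∧ M *ᵥ v = t • v := by
  rw [IsRoot, eval_charpoly] at h
  obtain ⟨v, hv, hv'⟩ := exists_mulVec_eq_zero_iff.mpr h
  refine ⟨v, hv, ?_⟩
  rw [sub_mulVec, sub_eq_zero] at hv'
  rw [← hv']
  ext i
  simp [scalar_apply, mulVec_diagonal]

lemma charpoly_isRoot_one_of_row_sum_one (M : Matrix ι ι K) [Nonempty ι]
    (hM : ∀ i, ∑ j, M i j = 1) : M.charpoly.IsRoot 1 := by
  rw [IsRoot, eval_charpoly, ← exists_mulVec_eq_zero_iff]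
  refine ⟨1, one_ne_zero, ?_⟩
  ext i
  rw [map_one, sub_mulVec, one_mulVec]
  simp [mulVec, dotProduct, hM]

lemma le_one_of_charpoly_isRoot_of_row_sum_one (M : Matrix ι ι ℝ) (h₀ : ∀ i j, 0 ≤ M i j)
    (hM : ∀ i, ∑ j, M i j = 1) {t : ℝ} (h : M.charpoly.IsRoot t) : t ≤ 1 := by
  obtain ⟨v, hv, hvt⟩ := exists_mulVec_eq_smul_of_charpoly_isRoot M h
  obtain ⟨k, hk⟩ := Function.ne_iff.mp hv
  obtain ⟨i, -, hi⟩ := Finset.exists_max_image Finset.univ (fun j => |v j|) ⟨k, Finset.mem_univ k⟩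
  have hpos : 0 < |v i| := (abs_pos.mpr hk).trans_le (hi k (Finset.mem_univ k))
  have hti : ∑ j, M i j * v j = t * v i := congrFun hvt i
  have : |t| * |v i| ≤ 1 * |v i| := by
    calc |t| * |v i| = |∑ j, M i j * v j| := by rw [hti, abs_mul]
      _ ≤ ∑ j, |M i j * v j| := Finset.abs_sum_le_sum_abs _ _
      _ ≤ ∑ j, M i j * |v i| := by
          refine Finset.sum_le_sum fun j hj => ?_
          rw [abs_mul, abs_of_nonneg (h₀ i j)]
          exact mul_le_mul_of_nonneg_left (hi j hj) (h₀ i j)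
      _ = 1 * |v i| := by rw [← Finset.sum_mul, hM]
  exact (le_abs_self t).trans (le_of_mul_le_mul_right this hpos)

end Matrix

namespace Finset

variable {ι : Type*} (s : Finset ι) (g : ι → ℝ)

lemma card_mul_sq_le_of_sum_eq_zero [DecidableEq ι] (h₀ : ∑ i ∈ s, g i = 0) {k : ι} (hk : k ∈ s) :
    (#s : ℝ) * g k ^ 2 ≤ ((#s : ℝ) - 1) * ∑ i ∈ s, g i ^ 2 := by
  have hcs := sq_sum_le_card_mul_sum_sq (s := s.erase k) (f := g)
  have hsum := s.add_sum_erase g hk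
  have hsq := s.add_sum_erase (fun i => g i ^ 2) hk
  have hcard : ((#(s.erase k) : ℕ) : ℝ) = #s - 1 := by
    rw [← card_erase_add_one hk]
    push_cast
    ring
  have he : ∑ i ∈ s.erase k, g i = -g k := by linarith
  have he₂ : ∑ i ∈ s.erase k, g i ^ 2 = ∑ i ∈ s, g i ^ 2 - g k ^ 2 := by
    linarith
  rw [hcard, he, he₂] at hcs
  linarith

lemma sum_sq_le_of_sum_eq_zero_of_le_s11 (h₀ : ∑ i ∈ s, g i = 0) {k : ι}
    (hmax : ∀ i ∈ s, g i ≤ g k) :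
    ∑ i ∈ s, g i ^ 2 ≤ (#s : ℝ) * ((#s : ℝ) - 1) * g k ^ 2 := by
  have h := sum_sq_le_sq_sum_of_nonneg (s := s) (f := fun i => g k - g i)
    fun i hi => sub_nonneg.mpr (hmax i hi)
  have e₁ : ∑ i ∈ s, (g k - g i) = #s * g k := by simp [h₀]
  have e₂ : ∑ i ∈ s, (g k - g i) ^ 2 = #s * g k ^ 2 + ∑ i ∈ s, g i ^ 2 := by
    have : ∀ i ∈ s, (g k - g i) ^ 2 = g k ^ 2 - 2 * g k * g i + g i ^ 2 := fun i _ => by ring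
    rw [sum_congr rfl this, sum_add_distrib, sum_sub_distrib, ← mul_sum, h₀]
    simp
  rw [e₁, e₂] at h
  linarith

lemma nonneg_of_sum_eq_zero_of_le (h₀ : ∑ i ∈ s, g i = 0) {k : ι} (hk : k ∈ s)
    (hmax : ∀ i ∈ s, g i ≤ g k) : 0 ≤ g k := by
  by_contra! hlt
  have := sum_neg (fun i hi => (hmax i hi).trans_lt hlt) ⟨k, hk⟩
  linarith

/-- The maximum of `m` reals with zero mean, compared with their sum of squares `T / m`. -/
lemma max_bounds_of_sum_eq_zero [DecidableEq ι] {T : ℝ} (h₀ : ∑ i ∈ s, g i = 0)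
    (hT : #s * ∑ i ∈ s, g i ^ 2 = T) {k : ι} (hk : k ∈ s) (hmax : ∀ i ∈ s, g i ≤ g k) :
    1 / (#s : ℝ) * √(T / (#s - 1)) ≤ g k ∧ g k ≤ 1 / (#s : ℝ) * √((#s - 1) * T) := by
  have hm : (1 : ℝ) ≤ #s := by exact_mod_cast card_pos.mpr ⟨k, hk⟩
  have hm' : (0 : ℝ) < #s := by linarith
  have hg := s.nonneg_of_sum_eq_zero_of_le g h₀ hk hmax
  have hup := mul_le_mul_of_nonneg_left (s.card_mul_sq_le_of_sum_eq_zero g h₀ hk) hm'.le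
  have hlow := mul_le_mul_of_nonneg_left (s.sum_sq_le_of_sum_eq_zero_of_le_s11 g h₀ hmax) hm'.le
  rw [hT] at hlow
  constructor
  · rw [one_div, inv_mul_le_iff₀ hm']
    apply Real.sqrt_le_iff.mpr
    refine ⟨by positivity, ?_⟩
    apply div_le_of_le_mul₀ (by linarith) (by positivity)
    linarith
  · rw [one_div, le_inv_mul_iff₀ hm']
    apply Real.le_sqrt_of_sq_le
    rw [← hT]
    linarith

end Finset

section NormAdj

variable {n : ℕ} (G : SimpleGraph (Fin n)) [DecidableRel G.Adj]

lemma normAdj_nonneg (i j : Fin n) : 0 ≤ normAdj G i j := by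
  simp only [normAdj, of_apply]
  split_ifs <;> positivity

lemma sum_normAdj {i : Fin n} (hi : 0 < G.degree i) : ∑ j, normAdj G i j = 1 := by
  have : (G.degree i : ℝ) ≠ 0 := by positivity
  simp only [normAdj, of_apply]
  rw [← Finset.sum_div, Finset.sum_boole, ← SimpleGraph.neighborFinset_eq_filter,
    SimpleGraph.card_neighborFinset_eq_degree, div_self this]

lemma trace_normAdj : (normAdj G).trace = 0 := by
  simp [Matrix.trace, normAdj]

lemma trace_normAdj_mul_self : (normAdj G * normAdj G).trace = 2 * randicM1 G := by
  rw [randicM1, mul_div_cancel₀ _ (two_ne_zero' ℝ)]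
  simp only [Matrix.trace, diag_apply, mul_apply, normAdj, of_apply]
  refine Finset.sum_congr rfl fun i _ => Finset.sum_congr rfl fun j _ => ?_
  by_cases h : G.Adj i j
  · simp [h, h.symm, mul_comm]
  · simp [h]

end NormAdj

/-- Bounds for the smallest and second largest eigenvalues of the
normalized adjacency matrix of a connected graph on `n` vertices in terms of the Randić
index `R_{-1}(G)`. The eigenvalues, in decreasing order with multiplicity, are encoded by
the antitone function `μ` through the factorization of the characteristic polynomial. -/
theorem stmt_11 {n : ℕ} (hn : 2 ≤ n) (G : SimpleGraph (Fin n)) [DecidableRel G.Adj]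
    (hconn : G.Connected)
    (μ : Fin n → ℝ) (hanti : Antitone μ)
    (hchar : (normAdj G).charpoly = ∏ i, (Polynomial.X - Polynomial.C (μ i))) :
    (-1 / ((n : ℝ) - 1) - (1 / ((n : ℝ) - 1)) *
          Real.sqrt (((n : ℝ) - 2) * (2 * ((n : ℝ) - 1) * randicM1 G - n))
        ≤ μ ⟨n - 1, by omega⟩ ∧
      μ ⟨n - 1, by omega⟩ ≤
        -1 / ((n : ℝ) - 1) - (1 / ((n : ℝ) - 1)) *
          Real.sqrt ((2 * ((n : ℝ) - 1) * randicM1 G - n) / ((n : ℝ) - 2))) ∧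
    (-1 / ((n : ℝ) - 1) + (1 / ((n : ℝ) - 1)) *
          Real.sqrt ((2 * ((n : ℝ) - 1) * randicM1 G - n) / ((n : ℝ) - 2))
        ≤ μ ⟨1, by omega⟩ ∧
      μ ⟨1, by omega⟩ ≤
        -1 / ((n : ℝ) - 1) + (1 / ((n : ℝ) - 1)) *
          Real.sqrt (((n : ℝ) - 2) * (2 * ((n : ℝ) - 1) * randicM1 G - n))) := by
  have hn₀ : 0 < n := by omega
  have hnR : (2 : ℝ) ≤ n := by exact_mod_cast hn
  have : Nontrivial (Fin n) := Fin.nontrivial_iff_two_le.mpr hn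
  let z : Fin n := ⟨0, hn₀⟩
  have hrow : ∀ i, ∑ j, normAdj G i j = 1 := fun i =>
    sum_normAdj G (hconn.preconnected.degree_pos_of_nontrivial i)
  have hz : μ z = 1 := by
    apply le_antisymm
    · apply le_one_of_charpoly_isRoot_of_row_sum_one (normAdj G) (normAdj_nonneg G) hrow
      rw [hchar, IsRoot, eval_prod]
      exact Finset.prod_eq_zero (Finset.mem_univ z) (by simp)
    · have h := charpoly_isRoot_one_of_row_sum_one (normAdj G) hrow
      rw [hchar, IsRoot, eval_prod, Finset.prod_eq_zero_iff] at h
      obtain ⟨i, -, hi⟩ := h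
      have hi' : (1 : ℝ) = μ i := by simpa [sub_eq_zero] using hi
      rw [hi']
      exact hanti (Fin.mk_le_of_le_val (Nat.zero_le _))
  let s : Finset (Fin n) := Finset.univ.erase z
  have hcard : ((s.card : ℕ) : ℝ) = (n : ℝ) - 1 := by
    simp [s, Finset.card_erase_of_mem, Nat.cast_sub hn₀]
  have hsum : ∑ i ∈ s, μ i = -1 := by
    have h := Finset.univ.add_sum_erase μ (Finset.mem_univ z)
    rw [← trace_eq_sum_of_charpoly_eq_prod _ _ hchar, trace_normAdj, hz] at h
    linarith
  have hsq : ∑ i ∈ s, μ i ^ 2 = 2 * randicM1 G - 1 := by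
    have h := Finset.univ.add_sum_erase (fun i => μ i ^ 2) (Finset.mem_univ z)
    rw [← trace_mul_self_of_charpoly_eq_prod _ _ hchar, trace_normAdj_mul_self, hz] at h
    linarith
  have hn₁ : (n : ℝ) - 1 ≠ 0 := by linarith
  let g : Fin n → ℝ := fun i => μ i - -1 / ((n : ℝ) - 1)
  have hg : ∑ i ∈ s, g i = 0 := by
    simp only [g]
    rw [Finset.sum_sub_distrib, hsum, Finset.sum_const, nsmul_eq_mul, hcard]
    field_simp
    ring
  have hg₂ : s.card * ∑ i ∈ s, g i ^ 2 = 2 * ((n : ℝ) - 1) * randicM1 G - n := by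
    have e : ∀ i ∈ s, g i ^ 2 =
        μ i ^ 2 + 2 / ((n : ℝ) - 1) * μ i + (1 / ((n : ℝ) - 1)) ^ 2 := fun i _ => by
      simp only [g]
      ring
    rw [Finset.sum_congr rfl e, Finset.sum_add_distrib, Finset.sum_add_distrib, ← Finset.mul_sum,
      hsum, hsq, Finset.sum_const, nsmul_eq_mul, hcard]
    field_simp
    ring
  have hlast : (⟨n - 1, by omega⟩ : Fin n) ∈ s :=
    Finset.mem_erase.mpr ⟨by simp [z, Fin.ext_iff]; omega, Finset.mem_univ _⟩
  have hsecond : (⟨1, by omega⟩ : Fin n) ∈ s :=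
    Finset.mem_erase.mpr ⟨by simp [z, Fin.ext_iff], Finset.mem_univ _⟩
  have htop := s.max_bounds_of_sum_eq_zero g hg hg₂ hsecond fun i hi => by
    refine sub_le_sub_right (hanti ?_) _
    have : i ≠ z := Finset.ne_of_mem_erase hi
    simp only [z, ne_eq, Fin.ext_iff] at this
    simp only [Fin.le_def]
    omega
  have hbot := s.max_bounds_of_sum_eq_zero (fun i => -g i) (by simp [hg]) (by simpa using hg₂)
    hlast fun i _ => by
      refine neg_le_neg (sub_le_sub_right (hanti ?_) _)
      simp only [Fin.le_def]
      omega
  have hn₂ : (n : ℝ) - 1 - 1 = n - 2 := by ring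
  rw [hcard, hn₂] at htop hbot
  simp only [g] at htop hbot
  refine ⟨⟨?_, ?_⟩, ?_, ?_⟩ <;> linarith [htop.1, htop.2, hbot.1, hbot.2]
end

section
/- Let G be a connected simple graph on n vertices possessing a dominating vertex i (i.e., d_i = n−1), and let λ₁ ≥ λ₂ ≥ … ≥ λₙ be the eigenvalues of the normalized adjacency matrix 𝒜 = D⁻¹A. Then λₙ ≥ −1/(n−1) − max_{j,k ≠ i, j ≠ k} √( (2 − 1/d_j − (2d_j−1)/(n−1)) · (2 − 1/d_k − (2d_k−1)/(n−1)) ) and λ₂ ≤ −1/(n−1) + max_{j,k ≠ i, j ≠ k} √( (2 − 1/d_j − (2d_j−1)/(n−1)) · (2 − 1/d_k − (2d_k−1)/(n−1)) ). -/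
set_option autoImplicit false

open Matrix Polynomial

/-- Brauer's oval of Cassini bound for a real eigenvalue of a matrix with constant diagonal `c`. -/
theorem exists_sq_sub_le_mul_of_sum_eq {ι : Type*} [DecidableEq ι] (s : Finset ι)
    (hs : 2 ≤ s.card) (M : Matrix ι ι ℝ) (w : ι → ℝ) (c t : ℝ)
    (hM : ∀ j ∈ s, (t - c) * w j = ∑ k ∈ s.erase j, M j k * w k)
    (hw : ∃ j ∈ s, w j ≠ 0) :
    ∃ j ∈ s, ∃ k ∈ s, j ≠ k ∧
      (t - c) ^ 2 ≤ (∑ l ∈ s.erase j, |M j l|) * ∑ l ∈ s.erase k, |M k l| := by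
  have bound : ∀ j ∈ s, ∀ b : ℝ, (∀ k ∈ s.erase j, |w k| ≤ b) →
      |t - c| * |w j| ≤ (∑ l ∈ s.erase j, |M j l|) * b := by
    intro j hj b hb
    rw [← abs_mul, hM j hj, Finset.sum_mul]
    refine (Finset.abs_sum_le_sum_abs _ _).trans (Finset.sum_le_sum fun k hk ↦ ?_)
    rw [abs_mul]
    exact mul_le_mul_of_nonneg_left (hb k hk) (abs_nonneg _)
  obtain ⟨x, hx, hwx⟩ := hw
  obtain ⟨j, hj, hjmax⟩ := s.exists_max_image (fun k ↦ |w k|) ⟨x, hx⟩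
  have hwj : 0 < |w j| := (abs_pos.2 hwx).trans_le (hjmax x hx)
  have hne : (s.erase j).Nonempty := by
    rw [← Finset.card_pos, Finset.card_erase_of_mem hj]
    omega
  obtain ⟨k, hk, hkmax⟩ := (s.erase j).exists_max_image (fun k ↦ |w k|) hne
  have hks := Finset.mem_of_mem_erase hk
  refine ⟨j, hj, k, hks, (Finset.ne_of_mem_erase hk).symm, ?_⟩
  have h₁ := bound j hj _ hkmax
  have h₂ := bound k hks |w j| fun l hl ↦ hjmax l (Finset.mem_of_mem_erase hl)
  have nonneg : ∀ a, 0 ≤ ∑ l ∈ s.erase a, |M a l| :=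
    fun a ↦ Finset.sum_nonneg fun _ _ ↦ abs_nonneg _
  rw [← sq_abs]
  rcases (abs_nonneg (w k)).eq_or_lt with h0 | hwk
  · have : |t - c| = 0 := by
      rw [← h0, mul_zero] at h₁
      nlinarith [abs_nonneg (t - c)]
    rw [this, zero_pow two_ne_zero]
    exact mul_nonneg (nonneg j) (nonneg k)
  · have h := mul_le_mul h₁ h₂ (by positivity) (mul_nonneg (nonneg j) (abs_nonneg _))
    exact le_of_mul_le_mul_right (by linear_combination h) (mul_pos hwj hwk)

/-- The characteristic polynomial of a matrix with unit row sums has the factor `X - 1`, the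
cofactor being obtained by replacing a column of the characteristic matrix with ones. -/
theorem charpoly_eq_mul_det_updateCol_one {ι R : Type*} [Fintype ι] [DecidableEq ι] [CommRing R]
    (P : Matrix ι ι R) (i : ι) (hP : ∀ j, ∑ k, P j k = 1) :
    P.charpoly = (X - 1) * (P.charmatrix.updateCol i 1).det := by
  have h := Matrix.det_updateCol_sum P.charmatrix i 1
  simp only [Pi.one_apply, one_smul] at h
  rw [Matrix.charpoly, ← h, ← Matrix.det_updateCol_smul]
  congr 2
  ext1 j
  simp only [Matrix.charmatrix_apply, Finset.sum_sub_distrib, ← map_sum, hP]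
  simp [Matrix.diagonal_apply]

/-- A root of the cofactor of `X - 1` is an eigenvalue of the matrix deflated by its `i`-th row. -/
theorem exists_deflated_eigenvector {ι K : Type*} [Fintype ι] [DecidableEq ι] [Field K]
    (P : Matrix ι ι K) (i : ι) (t : K) (ht : (P.charmatrix.updateCol i 1).det.IsRoot t) :
    ∃ w : ι → K, (∃ j ∈ Finset.univ.erase i, w j ≠ 0) ∧
      ∀ j ∈ Finset.univ.erase i, t * w j = ∑ k ∈ Finset.univ.erase i, (P j k - P i k) * w k := by
  rw [Polynomial.IsRoot, ← Polynomial.coe_evalRingHom, RingHom.map_det,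
    ← Matrix.exists_mulVec_eq_zero_iff] at ht
  obtain ⟨v, hv, h⟩ := ht
  have row : ∀ j, v i + ∑ k ∈ Finset.univ.erase i,
      ((if j = k then t else 0) - P j k) * v k = 0 := by
    intro j
    have hj := congrFun h j
    rw [Matrix.mulVec, dotProduct, ← Finset.add_sum_erase _ _ (Finset.mem_univ i)] at hj
    simp only [RingHom.mapMatrix_apply, Matrix.map_apply, Matrix.updateCol_self, Pi.one_apply,
      map_one, one_mul, Pi.zero_apply] at hj
    refine Eq.trans (congrArg _ (Finset.sum_congr rfl fun k hk ↦ ?_)) hj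
    rw [Matrix.updateCol_ne (Finset.ne_of_mem_erase hk), Matrix.charmatrix_apply,
      Matrix.diagonal_apply]
    split_ifs <;> simp
  have hi : v i = ∑ k ∈ Finset.univ.erase i, P i k * v k := by
    have := row i
    rw [Finset.sum_congr rfl (g := fun k ↦ -(P i k * v k)), Finset.sum_neg_distrib] at this
    · linear_combination this
    · intro k hk
      rw [if_neg (Finset.ne_of_mem_erase hk).symm]
      ring
  refine ⟨v, ?_, fun j hj ↦ ?_⟩
  · by_contra! h0
    refine hv (funext fun k ↦ ?_)
    by_cases hk : k = i
    · rw [hk, hi]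
      exact Finset.sum_eq_zero fun l hl ↦ by rw [h0 l hl, mul_zero]
    · exact h0 k (Finset.mem_erase.2 ⟨hk, Finset.mem_univ k⟩)
  · have := row j
    simp only [sub_mul, Finset.sum_sub_distrib, ite_mul, zero_mul, Finset.sum_ite_eq, if_pos hj]
      at this ⊢
    linear_combination this - hi

theorem sum_normAdj_row {n : ℕ} (G : SimpleGraph (Fin n)) [DecidableRel G.Adj] (j : Fin n)
    (hj : G.degree j ≠ 0) : ∑ k, normAdj G j k = 1 := by
  simp only [normAdj, Matrix.of_apply]
  rw [← Finset.sum_div, Finset.sum_boole, ← G.neighborFinset_eq_filter,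
    G.card_neighborFinset_eq_degree]
  exact div_self (Nat.cast_ne_zero.2 hj)

theorem adj_of_degree_eq_sub_one {n : ℕ} (G : SimpleGraph (Fin n)) [DecidableRel G.Adj]
    {i j : Fin n} (hdom : G.degree i = n - 1) (hij : j ≠ i) : G.Adj i j := by
  have h : G.neighborFinset i = Finset.univ.erase i := by
    refine Finset.eq_of_subset_of_card_le (fun k hk ↦ ?_) ?_
    · rw [SimpleGraph.mem_neighborFinset] at hk
      exact Finset.mem_erase.2 ⟨hk.ne', Finset.mem_univ k⟩
    · simp [hdom]
  rw [← SimpleGraph.mem_neighborFinset, h]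
  exact Finset.mem_erase.2 ⟨hij, Finset.mem_univ j⟩

/-- The absolute off-diagonal row sums of the normalized adjacency matrix deflated by the row of
a dominating vertex. -/
theorem sum_abs_normAdj_sub_of_dominating {n : ℕ} (G : SimpleGraph (Fin n)) [DecidableRel G.Adj]
    {i j : Fin n} (hdom : G.degree i = n - 1) (hij : j ≠ i) :
    ∑ k ∈ (Finset.univ.erase i).erase j, |normAdj G j k - normAdj G i k| =
      2 - 1 / (G.degree j : ℝ) - (2 * (G.degree j : ℝ) - 1) / ((n : ℝ) - 1) := by
  have hadj := adj_of_degree_eq_sub_one G hdom hij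
  have hn : 1 ≤ n := by have := j.isLt; omega
  have hcast : ((n - 1 : ℕ) : ℝ) = (n : ℝ) - 1 := by push_cast [hn]; ring
  have hd : 0 < G.degree j := (G.degree_pos_iff_exists_adj j).2 ⟨i, hadj.symm⟩
  have hdn : G.degree j ≤ n - 1 := by
    have := G.degree_lt_card_verts j
    rw [Fintype.card_fin] at this
    omega
  have hd' : (0 : ℝ) < G.degree j := Nat.cast_pos.2 hd
  have hdn' : (G.degree j : ℝ) ≤ (n : ℝ) - 1 := by
    rw [← hcast]
    exact_mod_cast hdn
  have hN : (0 : ℝ) < (n : ℝ) - 1 := hd'.trans_le hdn'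
  have hjmem : j ∈ Finset.univ.erase i := Finset.mem_erase.2 ⟨hij, Finset.mem_univ j⟩
  have hcard : (((Finset.univ.erase i).erase j).card : ℝ) = (n : ℝ) - 2 := by
    have h2 : 2 ≤ n := by omega
    rw [Finset.card_erase_of_mem hjmem, Finset.card_erase_of_mem (Finset.mem_univ i),
      Finset.card_univ, Fintype.card_fin, Nat.sub_sub]
    push_cast [h2]
    ring
  have hsum : ∑ k ∈ (Finset.univ.erase i).erase j, (if G.Adj j k then (1 : ℝ) else 0) =
      G.degree j - 1 := by
    have h : ∑ k, (if G.Adj j k then (1 : ℝ) else 0) = G.degree j := by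
      rw [Finset.sum_boole, ← G.neighborFinset_eq_filter, G.card_neighborFinset_eq_degree]
    rw [← Finset.add_sum_erase _ _ (Finset.mem_univ i), ← Finset.add_sum_erase _ _ hjmem,
      if_pos hadj.symm, if_neg (G.irrefl)] at h
    linarith
  have hterm : ∀ k ∈ (Finset.univ.erase i).erase j, |normAdj G j k - normAdj G i k| =
      1 / ((n : ℝ) - 1) + (if G.Adj j k then (1 : ℝ) else 0) *
        (1 / (G.degree j : ℝ) - 2 / ((n : ℝ) - 1)) := by
    intro k hk
    have hik := adj_of_degree_eq_sub_one G hdom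
      (Finset.ne_of_mem_erase (Finset.mem_of_mem_erase hk))
    simp only [normAdj, Matrix.of_apply, if_pos hik, hdom, hcast]
    split_ifs
    · rw [abs_of_nonneg (sub_nonneg.2 (one_div_le_one_div_of_le hd' hdn'))]
      ring
    · rw [zero_div, zero_sub, abs_neg, abs_of_pos (one_div_pos.2 hN)]
      ring
  rw [Finset.sum_congr rfl hterm, Finset.sum_add_distrib, ← Finset.sum_mul, hsum,
    Finset.sum_const, nsmul_eq_mul, hcard]
  field_simp
  ring

/-- For a connected graph on `n` vertices with a dominating vertex `i`
(`d_i = n - 1`), the eigenvalues of the normalized adjacency matrix (in decreasing order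
with multiplicity, encoded by the antitone `μ` via the characteristic polynomial) satisfy
`λₙ ≥ -1/(n-1) - M` and `λ₂ ≤ -1/(n-1) + M`, where `M` is the maximum over pairs of
distinct vertices `j, k ≠ i` of
`√((2 - 1/d_j - (2d_j - 1)/(n-1)) · (2 - 1/d_k - (2d_k - 1)/(n-1)))`. -/
theorem stmt_14 {n : ℕ} (hn : 3 ≤ n) (G : SimpleGraph (Fin n)) [DecidableRel G.Adj]
    (hconn : G.Connected) (i : Fin n) (hdom : G.degree i = n - 1)
    (μ : Fin n → ℝ) (hanti : Antitone μ)
    (hchar : (normAdj G).charpoly = ∏ i, (Polynomial.X - Polynomial.C (μ i))) :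
    μ ⟨n - 1, by omega⟩ ≥
      -1 / ((n : ℝ) - 1) -
        (⨆ p : {p : Fin n × Fin n // p.1 ≠ i ∧ p.2 ≠ i ∧ p.1 ≠ p.2},
          Real.sqrt
            ((2 - 1 / (G.degree p.1.1 : ℝ) - (2 * (G.degree p.1.1 : ℝ) - 1) / ((n : ℝ) - 1)) *
              (2 - 1 / (G.degree p.1.2 : ℝ) -
                (2 * (G.degree p.1.2 : ℝ) - 1) / ((n : ℝ) - 1)))) ∧
    μ ⟨1, by omega⟩ ≤
      -1 / ((n : ℝ) - 1) +
        (⨆ p : {p : Fin n × Fin n // p.1 ≠ i ∧ p.2 ≠ i ∧ p.1 ≠ p.2},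
          Real.sqrt
            ((2 - 1 / (G.degree p.1.1 : ℝ) - (2 * (G.degree p.1.1 : ℝ) - 1) / ((n : ℝ) - 1)) *
              (2 - 1 / (G.degree p.1.2 : ℝ) -
                (2 * (G.degree p.1.2 : ℝ) - 1) / ((n : ℝ) - 1)))) := by
  set M := ⨆ p : {p : Fin n × Fin n // p.1 ≠ i ∧ p.2 ≠ i ∧ p.1 ≠ p.2},
    Real.sqrt
      ((2 - 1 / (G.degree p.1.1 : ℝ) - (2 * (G.degree p.1.1 : ℝ) - 1) / ((n : ℝ) - 1)) *
        (2 - 1 / (G.degree p.1.2 : ℝ) -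
          (2 * (G.degree p.1.2 : ℝ) - 1) / ((n : ℝ) - 1)))
  have hM0 : 0 ≤ M := Real.iSup_nonneg fun _ ↦ Real.sqrt_nonneg _
  have hN : (0 : ℝ) < (n : ℝ) - 1 := by
    have : (3 : ℝ) ≤ n := by exact_mod_cast hn
    linarith
  have hcast : ((n - 1 : ℕ) : ℝ) = (n : ℝ) - 1 := by
    push_cast [(by omega : 1 ≤ n)]
    ring
  have hrow : ∀ j, ∑ k, normAdj G j k = 1 := by
    refine fun j ↦ sum_normAdj_row G j ?_
    by_cases hj : j = i
    · rw [hj, hdom]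
      omega
    · exact ((G.degree_pos_iff_exists_adj j).2
        ⟨i, (adj_of_degree_eq_sub_one G hdom hj).symm⟩).ne'
  set q := ((normAdj G).charmatrix.updateCol i 1).det
  have hq : (X - 1) * q = ∏ j, (X - C (μ j)) := by
    rw [← hchar, charpoly_eq_mul_det_updateCol_one _ i hrow]
  have key : ∀ t, q.IsRoot t → |t - -1 / ((n : ℝ) - 1)| ≤ M := by
    intro t ht
    obtain ⟨w, hw, hwt⟩ := exists_deflated_eigenvector _ i t ht
    obtain ⟨j, hj, k, hk, hjk, hle⟩ := exists_sq_sub_le_mul_of_sum_eq (Finset.univ.erase i)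
      (by rw [Finset.card_erase_of_mem (Finset.mem_univ i), Finset.card_univ,
        Fintype.card_fin]; omega)
      (Matrix.of fun j k ↦ normAdj G j k - normAdj G i k) w (-1 / ((n : ℝ) - 1)) t
      (fun j hj ↦ by
        have hadj := adj_of_degree_eq_sub_one G hdom (Finset.ne_of_mem_erase hj)
        have hdiag : normAdj G j j - normAdj G i j = -1 / ((n : ℝ) - 1) := by
          simp [normAdj, hadj, hdom, hcast, neg_div]
        have := hwt j hj
        rw [← Finset.add_sum_erase _ _ hj, hdiag] at this
        simp only [Matrix.of_apply]
        linear_combination this) hw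
    have hj' := Finset.ne_of_mem_erase hj
    have hk' := Finset.ne_of_mem_erase hk
    simp only [Matrix.of_apply, sum_abs_normAdj_sub_of_dominating G hdom hj',
      sum_abs_normAdj_sub_of_dominating G hdom hk'] at hle
    exact (Real.abs_le_sqrt hle).trans
      (le_ciSup (f := fun p : {p : Fin n × Fin n // p.1 ≠ i ∧ p.2 ≠ i ∧ p.1 ≠ p.2} ↦ Real.sqrt
        ((2 - 1 / (G.degree p.1.1 : ℝ) - (2 * (G.degree p.1.1 : ℝ) - 1) / ((n : ℝ) - 1)) *
          (2 - 1 / (G.degree p.1.2 : ℝ) -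
            (2 * (G.degree p.1.2 : ℝ) - 1) / ((n : ℝ) - 1))))
        (Set.finite_range _).bddAbove ⟨(j, k), hj', hk', hjk⟩)
  have root_of_ne : ∀ j, μ j ≠ 1 → q.IsRoot (μ j) := by
    intro j hj
    have h := congrArg (Polynomial.eval (μ j)) hq
    rw [Polynomial.eval_prod, Finset.prod_eq_zero (Finset.mem_univ j) (by simp),
      Polynomial.eval_mul] at h
    refine (mul_eq_zero.1 h).resolve_left ?_
    simpa [sub_eq_zero] using hj
  have root_of_eq : ∀ j k, j ≠ k → μ k = 1 → q.IsRoot (μ j) := by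
    intro j k hjk hk
    rw [← Finset.mul_prod_erase _ _ (Finset.mem_univ k), hk, map_one] at hq
    have h1 : (X - 1 : ℝ[X]) ≠ 0 := by simpa using Polynomial.X_sub_C_ne_zero (1 : ℝ)
    rw [mul_left_cancel₀ h1 hq, Polynomial.IsRoot, Polynomial.eval_prod]
    exact Finset.prod_eq_zero (Finset.mem_erase.2 ⟨hjk, Finset.mem_univ j⟩) (by simp)
  constructor
  · by_cases h : μ ⟨n - 1, by omega⟩ = 1
    · have : -1 / ((n : ℝ) - 1) ≤ 0 := div_nonpos_of_nonpos_of_nonneg (by norm_num) hN.le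
      linarith
    · linarith [(abs_le.1 (key _ (root_of_ne _ h))).1]
  · by_cases h : μ ⟨1, by omega⟩ = 1
    · have h01 : (⟨0, by omega⟩ : Fin n) ≠ ⟨1, by omega⟩ := by simp
      have hle : μ ⟨1, by omega⟩ ≤ μ ⟨0, by omega⟩ := hanti (by simp)
      linarith [(abs_le.1 (key _ (root_of_eq _ _ h01 h))).2]
    · linarith [(abs_le.1 (key _ (root_of_ne _ h))).2]
end

section
/- Let G be a connected simple graph on n vertices with Laplacian matrix L = (l_{ij}). Then for every k ∈ {1,…,n}, every nonzero eigenvalue of L is an eigenvalue of the (n−1)×(n−1) matrix L(k) with entries L(k)_{jl} = l_{jl} − l_{kl} for j,l ≠ k. -/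
set_option autoImplicit false

open Matrix

/-- If all rows of `M` have equal sums, then subtracting row `k` and deleting the index `k`
sends the vector `v - v k` to `M v - (M v) k`. -/
lemma mulVec_sub_row_of_sum_eq {ι R : Type*} [Fintype ι] [DecidableEq ι] [CommRing R]
    (M : Matrix ι ι R) (k : ι) (hM : ∀ i, ∑ l, M i l = ∑ l, M k l) (v : ι → R)
    (j : {j : ι // j ≠ k}) :
    (Matrix.of fun (j l : {j : ι // j ≠ k}) => M j.1 l.1 - M k l.1).mulVec
        (fun l => v l.1 - v k) j = M.mulVec v j.1 - M.mulVec v k := by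
  simp only [mulVec, dotProduct, of_apply]
  have hfull : ∑ l : {l : ι // l ≠ k}, (M j.1 l.1 - M k l.1) * (v l.1 - v k) =
      ∑ l, (M j.1 l - M k l) * (v l - v k) := by
    rw [Fintype.sum_eq_add_sum_subtype_ne _ k]
    simp
  rw [hfull]
  simp only [sub_mul, mul_sub, Finset.sum_sub_distrib, ← Finset.sum_mul, hM j.1]
  ring

/-- For a connected graph `G` on `n` vertices with Laplacian matrix
`L`, for every index `k`, every nonzero eigenvalue of `L` is an eigenvalue of the
`(n-1) × (n-1)` matrix `L(k)` with entries `L(k)_{jl} = l_{jl} - l_{kl}` for `j, l ≠ k`. -/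
theorem stmt_15 {n : ℕ} (G : SimpleGraph (Fin n)) [DecidableRel G.Adj]
    (hconn : G.Connected) (k : Fin n) (μ : ℝ) (hμ : μ ≠ 0)
    (v : Fin n → ℝ) (hv : v ≠ 0) (hev : (G.lapMatrix ℝ).mulVec v = μ • v) :
    ∃ w : {j : Fin n // j ≠ k} → ℝ, w ≠ 0 ∧
      (Matrix.of fun (j l : {j : Fin n // j ≠ k}) =>
          G.lapMatrix ℝ j.1 l.1 - G.lapMatrix ℝ k l.1).mulVec w = μ • w := by
  have hrow : ∀ i, ∑ l, G.lapMatrix ℝ i l = 0 := fun i => by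
    simpa [mulVec, dotProduct] using
      congrFun (G.lapMatrix_mulVec_const_eq_zero (R := ℝ)) i
  refine ⟨fun l => v l.1 - v k, fun hw => hv ?_, ?_⟩
  · have hconst : v = fun _ => v k := by
      funext j
      by_cases hj : j = k
      · rw [hj]
      · exact sub_eq_zero.mp (congrFun hw ⟨j, hj⟩)
    have hL : (G.lapMatrix ℝ).mulVec v = 0 := by
      rw [hconst]
      funext i
      simp [mulVec, dotProduct, ← Finset.sum_mul, hrow]
    rw [hL] at hev
    exact (smul_eq_zero.mp hev.symm).resolve_left hμ
  · funext j
    rw [mulVec_sub_row_of_sum_eq _ k (fun i => by rw [hrow, hrow]), hev]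
    simp [mul_sub]
end

section
/- Let G be a connected simple graph on n vertices possessing a dominating vertex i (i.e., d_i = n−1), with Laplacian eigenvalues λ₁ ≥ λ₂ ≥ … ≥ λ_{n−1} ≥ λₙ = 0. Then λ₁ ≤ (1/2)·max_{j,k ≠ i, j ≠ k} ( d_j + d_k + 2 + √( (d_j − d_k)² + 4(n − d_j)(n − d_k) ) ) and λ_{n−1} ≥ (1/2)·min_{j,k ≠ i, j ≠ k} ( d_j + d_k + 2 − √( (d_j − d_k)² + 4(n − d_j)(n − d_k) ) ). -/
set_option autoImplicit false

open Matrix Polynomial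

namespace SimpleGraph

variable {V : Type*} [Fintype V] [DecidableEq V] (G : SimpleGraph V) [DecidableRel G.Adj]

/-- An eigenvector of the Laplacian for a nonzero eigenvalue is orthogonal to the constants. -/
theorem sum_eq_zero_of_lapMatrix_mulVec_eq_smul {x : V → ℝ} {l : ℝ} (hl : l ≠ 0)
    (hx : G.lapMatrix ℝ *ᵥ x = l • x) : ∑ v, x v = 0 := by
  have h : (fun _ ↦ 1) ⬝ᵥ (G.lapMatrix ℝ *ᵥ x) = 0 := by
    rw [dotProduct_mulVec, ← mulVec_transpose, (G.isSymm_lapMatrix (R := ℝ)).eq,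
      lapMatrix_mulVec_const_eq_zero, zero_dotProduct]
  rw [hx, dotProduct_smul, smul_eq_mul, mul_eq_zero] at h
  simpa [dotProduct] using h.resolve_left hl

theorem lapMatrix_compl_mulVec_of_sum_eq_zero {x : V → ℝ} (hx : ∑ v, x v = 0) :
    Gᶜ.lapMatrix ℝ *ᵥ x = (Fintype.card V : ℝ) • x - G.lapMatrix ℝ *ᵥ x := by
  ext v
  have hd : (Gᶜ.degree v : ℝ) = Fintype.card V - 1 - G.degree v := by
    have := G.degree_lt_card_verts v
    rw [degree_compl, Nat.cast_sub (by omega), Nat.cast_sub (by omega), Nat.cast_one]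
  have h₁ := Finset.sum_add_sum_compl (G.neighborFinset v) x
  have h₂ := Finset.sum_sdiff (f := x) (s₁ := {v}) (s₂ := (G.neighborFinset v)ᶜ) (by simp)
  rw [← neighborFinset_compl, Finset.sum_singleton] at h₂
  simp only [lapMatrix_mulVec_apply, Pi.sub_apply, Pi.smul_apply, smul_eq_mul, hd]
  linarith

/-- A Laplacian eigenvalue with an eigenvector supported in `s` is at most the sum of the degrees
of two distinct vertices of `s`. -/
theorem exists_le_degree_add_degree_of_lapMatrix_mulVec_eq_smul {x : V → ℝ} {l : ℝ}
    (hx0 : x ≠ 0) (hx : G.lapMatrix ℝ *ᵥ x = l • x) {s : Finset V} (hs : s.Nontrivial)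
    (hsupp : ∀ v ∉ s, x v = 0) :
    ∃ j ∈ s, ∃ k ∈ s, j ≠ k ∧ l ≤ G.degree j + G.degree k := by
  obtain ⟨j, hj, hjmax⟩ := s.exists_max_image (fun v ↦ |x v|) hs.nonempty
  obtain ⟨k, hk, hkmax⟩ := (s.erase j).exists_max_image (fun v ↦ |x v|)
    (Finset.erase_nonempty hj |>.2 hs)
  have hjmax' (u : V) : |x u| ≤ |x j| := by
    by_cases hu : u ∈ s
    · exact hjmax u hu
    · simp [hsupp u hu]
  have hkmax' (u : V) (huj : u ≠ j) : |x u| ≤ |x k| := by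
    by_cases hu : u ∈ s
    · exact hkmax u (Finset.mem_erase.2 ⟨huj, hu⟩)
    · simp [hsupp u hu]
  have hjpos : 0 < |x j| := by
    obtain ⟨u, hu⟩ := Function.ne_iff.1 hx0
    exact (abs_pos.2 hu).trans_le (hjmax' u)
  have key (v : V) (b : ℝ) (hb : ∀ u, G.Adj v u → |x u| ≤ b) :
      (l - G.degree v) * |x v| ≤ G.degree v * b := by
    have h := congrFun hx v
    rw [lapMatrix_mulVec_apply, Pi.smul_apply, smul_eq_mul] at h
    calc (l - G.degree v) * |x v| ≤ |(l - G.degree v) * x v| := by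
          rw [abs_mul]
          exact mul_le_mul_of_nonneg_right (le_abs_self _) (abs_nonneg _)
      _ = |∑ u ∈ G.neighborFinset v, x u| := by
          rw [← abs_neg]
          congr 1
          linarith
      _ ≤ ∑ u ∈ G.neighborFinset v, |x u| := Finset.abs_sum_le_sum_abs _ _
      _ ≤ ∑ _u ∈ G.neighborFinset v, b :=
          Finset.sum_le_sum fun u hu ↦ hb u (by simpa using hu)
      _ = G.degree v * b := by simp
  have h₁ := key j |x k| fun u hu ↦ hkmax' u hu.ne'
  have h₂ := key k |x j| fun u _ ↦ hjmax' u
  refine ⟨j, hj, k, Finset.mem_of_mem_erase hk, (Finset.ne_of_mem_erase hk).symm, ?_⟩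
  by_contra! hlt
  have h₃ := mul_lt_mul_of_pos_right hlt hjpos
  have h₄ := mul_le_mul_of_nonneg_right hlt.le (abs_nonneg (x k))
  linarith

/-- Zero is a simple Laplacian eigenvalue of a connected graph. -/
theorem Connected.card_eigenvalues_lapMatrix_eq_zero {G : SimpleGraph V} [DecidableRel G.Adj]
    (hG : G.Connected) (hA : (G.lapMatrix ℝ).IsHermitian) :
    Fintype.card {v // hA.eigenvalues v = 0} = 1 := by
  classical
  have h₁ := card_connectedComponent_eq_finrank_ker_toLin'_lapMatrix G
  have h₂ : Fintype.card G.ConnectedComponent = 1 := by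
    have := hG.preconnected.subsingleton_connectedComponent
    have := hG.nonempty
    have := ‹Nonempty V›.map G.connectedComponentMk
    exact le_antisymm (Fintype.card_le_one_iff_subsingleton.2 inferInstance) Fintype.card_pos
  have h₃ := hA.rank_eq_card_non_zero_eigs
  have h₄ := (toLin' (G.lapMatrix ℝ)).finrank_range_add_finrank_ker
  rw [Module.finrank_fintype_fun_eq_card] at h₄
  change (G.lapMatrix ℝ).rank + _ = _ at h₄
  have h₅ := Fintype.card_subtype_compl (fun v ↦ hA.eigenvalues v = 0)
  have h₆ := Fintype.card_subtype_le (fun v ↦ hA.eigenvalues v = 0)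
  simp only [ne_eq] at h₃
  omega

end SimpleGraph

theorem Matrix.exists_mulVec_eq_smul_of_isRoot_charpoly {m K : Type*} [Fintype m] [DecidableEq m]
    [Field K] {A : Matrix m m K} {a : K} (h : A.charpoly.IsRoot a) :
    ∃ x ≠ 0, A *ᵥ x = a • x := by
  rw [IsRoot, eval_charpoly, ← exists_mulVec_eq_zero_iff] at h
  obtain ⟨x, hx0, hx⟩ := h
  refine ⟨x, hx0, ?_⟩
  rw [sub_mulVec, sub_eq_zero] at hx
  simpa [scalar_apply, ← smul_one_eq_diagonal, smul_mulVec] using hx.symm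

theorem Matrix.PosSemidef.nonneg_of_mulVec_eq_smul {m : Type*} [Fintype m]
    {A : Matrix m m ℝ} (hA : A.PosSemidef) {x : m → ℝ} (hx0 : x ≠ 0) {a : ℝ}
    (hx : A *ᵥ x = a • x) : 0 ≤ a := by
  have h := hA.dotProduct_mulVec_nonneg x
  rw [hx, star_trivial, dotProduct_smul, smul_eq_mul] at h
  have hpos : 0 < x ⬝ᵥ x := by simpa using dotProduct_star_self_pos_iff.2 hx0
  exact nonneg_of_mul_nonneg_left h hpos




/-- For a connected graph on `n` vertices with a dominating vertex `i`
(`d_i = n - 1`) and Laplacian eigenvalues `λ₁ ≥ … ≥ λ_{n-1} ≥ λₙ = 0` (encoded by the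
antitone `μ` via the characteristic polynomial),
`λ₁ ≤ (1/2)·max_{j,k ≠ i, j ≠ k}(d_j + d_k + 2 + √((d_j - d_k)² + 4(n - d_j)(n - d_k)))`
and
`λ_{n-1} ≥ (1/2)·min_{j,k ≠ i, j ≠ k}(d_j + d_k + 2 - √((d_j - d_k)² + 4(n - d_j)(n - d_k)))`. -/
theorem stmt_18 {n : ℕ} (hn : 3 ≤ n) (G : SimpleGraph (Fin n)) [DecidableRel G.Adj]
    (hconn : G.Connected) (i : Fin n) (hdom : G.degree i = n - 1)
    (μ : Fin n → ℝ) (hanti : Antitone μ)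
    (hchar : (G.lapMatrix ℝ).charpoly = ∏ i, (Polynomial.X - Polynomial.C (μ i))) :
    μ ⟨0, by omega⟩ ≤
      (1 / 2) * (⨆ p : {p : Fin n × Fin n // p.1 ≠ i ∧ p.2 ≠ i ∧ p.1 ≠ p.2},
        ((G.degree p.1.1 : ℝ) + (G.degree p.1.2 : ℝ) + 2 +
          Real.sqrt (((G.degree p.1.1 : ℝ) - (G.degree p.1.2 : ℝ)) ^ 2 +
            4 * ((n : ℝ) - (G.degree p.1.1 : ℝ)) * ((n : ℝ) - (G.degree p.1.2 : ℝ))))) ∧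
    μ ⟨n - 2, by omega⟩ ≥
      (1 / 2) * (⨅ p : {p : Fin n × Fin n // p.1 ≠ i ∧ p.2 ≠ i ∧ p.1 ≠ p.2},
        ((G.degree p.1.1 : ℝ) + (G.degree p.1.2 : ℝ) + 2 -
          Real.sqrt (((G.degree p.1.1 : ℝ) - (G.degree p.1.2 : ℝ)) ^ 2 +
            4 * ((n : ℝ) - (G.degree p.1.1 : ℝ)) * ((n : ℝ) - (G.degree p.1.2 : ℝ))))) := by
  have hsqrt (j k : Fin n) : Real.sqrt (((G.degree j : ℝ) - G.degree k) ^ 2 +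
      4 * ((n : ℝ) - G.degree j) * ((n : ℝ) - G.degree k)) =
      2 * n - G.degree j - G.degree k := by
    have hle (v : Fin n) : (G.degree v : ℝ) ≤ n := by
      have := G.degree_lt_card_verts v
      rw [Fintype.card_fin] at this
      exact_mod_cast this.le
    rw [← Real.sqrt_sq (by linarith [hle j, hle k] : 0 ≤ 2 * (n : ℝ) - G.degree j - G.degree k)]
    congr 1
    ring
  simp only [hsqrt]
  have hA := G.isHermitian_lapMatrix ℝ
  have heig (a : Fin n) : ∃ x ≠ 0, G.lapMatrix ℝ *ᵥ x = μ a • x := by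
    refine exists_mulVec_eq_smul_of_isRoot_charpoly ?_
    rw [hchar, IsRoot, eval_prod]
    exact Finset.prod_eq_zero (Finset.mem_univ a) (by simp)
  have hnonneg (a : Fin n) : 0 ≤ μ a := by
    obtain ⟨x, hx0, hx⟩ := heig a
    exact (G.posSemidef_lapMatrix ℝ).nonneg_of_mulVec_eq_smul hx0 hx
  have hcompl {a : Fin n} (ha : μ a ≠ 0) {x : Fin n → ℝ} (hx : G.lapMatrix ℝ *ᵥ x = μ a • x) :
      Gᶜ.lapMatrix ℝ *ᵥ x = ((n : ℝ) - μ a) • x := by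
    rw [G.lapMatrix_compl_mulVec_of_sum_eq_zero
      (G.sum_eq_zero_of_lapMatrix_mulVec_eq_smul ha hx), hx, Fintype.card_fin, sub_smul]
  have hle (a : Fin n) : μ a ≤ n := by
    rcases eq_or_ne (μ a) 0 with ha | ha
    · simp [ha]
    · obtain ⟨x, hx0, hx⟩ := heig a
      exact sub_nonneg.1 ((Gᶜ.posSemidef_lapMatrix ℝ).nonneg_of_mulVec_eq_smul hx0 (hcompl ha hx))
  have hpos : μ ⟨n - 2, by omega⟩ ≠ 0 := by
    intro h0
    have h1 : μ ⟨n - 1, by omega⟩ = 0 :=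
      le_antisymm (h0 ▸ hanti (Fin.mk_le_mk.2 (by omega))) (hnonneg _)
    have hroots : Finset.univ.val.map μ = Finset.univ.val.map hA.eigenvalues := by
      have h := hA.roots_charpoly_eq_eigenvalues
      rw [hchar, roots_prod _ _ (Finset.prod_ne_zero_iff.2 fun a _ ↦ X_sub_C_ne_zero _)] at h
      simpa using h
    have hcard := congrArg (Multiset.count 0) hroots
    rw [Multiset.count_map, Multiset.count_map] at hcard
    change (Finset.univ.filter fun a ↦ 0 = μ a).card =
      (Finset.univ.filter fun a ↦ 0 = hA.eigenvalues a).card at hcard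
    have hone := hconn.card_eigenvalues_lapMatrix_eq_zero hA
    rw [Fintype.card_subtype] at hone
    have htwo : 1 < (Finset.univ.filter fun a ↦ μ a = 0).card := by
      refine Finset.one_lt_card.2 ⟨_, by simpa using h0, _, by simpa using h1, ?_⟩
      simp only [ne_eq, Fin.mk.injEq]
      omega
    simp only [eq_comm (a := (0 : ℝ))] at hcard
    omega
  have hnontriv : (Finset.univ.erase i).Nontrivial := by
    rw [← Finset.one_lt_card_iff_nontrivial, Finset.card_erase_of_mem (Finset.mem_univ i)]
    simp only [Finset.card_univ, Fintype.card_fin]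
    omega
  obtain ⟨j₀, hj₀, k₀, hk₀, hjk₀⟩ := hnontriv
  have hn₀ : Nonempty {p : Fin n × Fin n // p.1 ≠ i ∧ p.2 ≠ i ∧ p.1 ≠ p.2} :=
    ⟨(j₀, k₀), by simpa using hj₀, by simpa using hk₀, hjk₀⟩
  constructor
  · refine (hle _).trans ?_
    ring_nf
    rw [ciSup_const]
    linarith
  · obtain ⟨j, hj, k, hk, hjk, h⟩ : ∃ j ≠ i, ∃ k ≠ i, j ≠ k ∧
        (G.degree j : ℝ) + G.degree k + 1 - n ≤ μ ⟨n - 2, by omega⟩ := by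
      have hd (v : Fin n) : (G.degree v : ℝ) + 1 ≤ n := by
        have := G.degree_lt_card_verts v
        rw [Fintype.card_fin] at this
        exact_mod_cast this
      rcases eq_or_ne (μ ⟨n - 2, by omega⟩) n with hμ | hμ
      · refine ⟨j₀, by simpa using hj₀, k₀, by simpa using hk₀, hjk₀, ?_⟩
        linarith [hd j₀, hd k₀]
      · obtain ⟨x, hx0, hx⟩ := heig ⟨n - 2, by omega⟩
        have hx' := hcompl hpos hx
        have hdeg (v : Fin n) : (Gᶜ.degree v : ℝ) = n - 1 - G.degree v := by
          have := G.degree_lt_card_verts v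
          rw [Fintype.card_fin] at this
          rw [G.degree_compl, Fintype.card_fin, Nat.cast_sub (by omega),
            Nat.cast_sub (by omega), Nat.cast_one]
        have hxi : x i = 0 := by
          have hzero : Gᶜ.degree i = 0 := by
            rw [G.degree_compl, Fintype.card_fin, hdom, Nat.sub_self]
          have hempty : Gᶜ.neighborFinset i = ∅ := Finset.card_eq_zero.1 hzero
          have h := congrFun hx' i
          rw [SimpleGraph.lapMatrix_mulVec_apply, hzero, hempty] at h
          simpa [sub_ne_zero.2 hμ.symm] using h
        obtain ⟨j, hj, k, hk, hjk, h⟩ :=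
          Gᶜ.exists_le_degree_add_degree_of_lapMatrix_mulVec_eq_smul hx0 hx'
            (s := Finset.univ.erase i) ⟨j₀, hj₀, k₀, hk₀, hjk₀⟩ (by simpa using hxi)
        refine ⟨j, by simpa using hj, k, by simpa using hk, hjk, ?_⟩
        linarith [hdeg j, hdeg k]
    refine le_trans ?_ h
    refine (mul_le_mul_of_nonneg_left
      (ciInf_le (Set.finite_range _).bddBelow ⟨(j, k), hj, hk, hjk⟩) (by norm_num)).trans ?_
    dsimp only
    linarith
end
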